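/- Let n ≥ 1 and let A ∈ ℝ^{n×n} be a symmetric {0,1}-valued matrix with zero diagonal. Suppose P ∈ {-1,1}^{k×n} and a diagonal matrix W ∈ ℝ^{k×k} satisfy PᵀWP ⊙ J = A, let r be the number of nonzero diagonal entries of W, and assume r > 1 and that W is L0-optimal: for every k' ≥ 1, every P' ∈ {-1,1}^{k'×n} and diagonal W' ∈ ℝ^{k'×k'} with P'ᵀW'P' ⊙ J = A, the number of nonzero diagonal entries of W' is at least r. Then every diagonal entry of W satisfies |W_{a,a}| ≤ (3n − 2)^{(3n−1)/2}. -/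

import Mathlib

open Matrix

/-- The intrinsic coupling matrix `J` with `J i j = 1` for `i ≠ j` and `0` on the diagonal. -/
def Jmat (n : ℕ) : Matrix (Fin n) (Fin n) ℝ :=
  fun i j => if i = j then 0 else 1

/-- `A` is constructible in `k` pulses: there are `P ∈ {-1,1}^{k×n}` and a diagonal
`W ∈ ℝ^{k×k}` with `Pᵀ W P ⊙ J = A`. -/
def Constructible (n k : ℕ) (A : Matrix (Fin n) (Fin n) ℝ) : Prop :=
  ∃ (P : Matrix (Fin k) (Fin n) ℝ) (W : Matrix (Fin k) (Fin k) ℝ),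
    (∀ a i, P a i = 1 ∨ P a i = -1) ∧ W.IsDiag ∧
      (Pᵀ * W * P).hadamard (Jmat n) = A

/-- **Hadamard's inequality** for real matrices with entries of absolute value at most one. -/
theorem abs_det_le_sqrt_card_pow {ι : Type*} [Fintype ι] [DecidableEq ι] (M : Matrix ι ι ℝ)
    (hM : ∀ i j, |M i j| ≤ 1) :
    |M.det| ≤ √(Fintype.card ι) ^ Fintype.card ι := by
  set n := Fintype.card ι with hn
  let e : Fin n ≃ ι := (Fintype.equivFin ι).symm
  let b := EuclideanSpace.basisFun (Fin n) ℝ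
  let v : Fin n → EuclideanSpace ℝ (Fin n) := fun j => WithLp.toLp 2 fun i => M (e i) (e j)
  have : Fact (Module.finrank ℝ (EuclideanSpace ℝ (Fin n)) = n) := ⟨by simp⟩
  have hdet : M.det = b.toBasis.det v := by
    rw [Module.Basis.det_apply, ← Matrix.det_submatrix_equiv_self e]
    congr 1
  rw [hdet, ← b.toBasis.orientation.volumeForm_robust' b v]
  refine (b.toBasis.orientation.abs_volumeForm_apply_le v).trans ?_
  calc ∏ i, ‖v i‖ ≤ ∏ _i : Fin n, √n := by
        refine Finset.prod_le_prod (fun _ _ => norm_nonneg _) fun j _ => ?_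
        rw [EuclideanSpace.norm_eq]
        refine Real.sqrt_le_sqrt ?_
        calc ∑ i, ‖v j i‖ ^ 2 ≤ ∑ _i : Fin n, (1 : ℝ) :=
              Finset.sum_le_sum fun i _ => pow_le_one₀ (norm_nonneg _) (hM _ _)
          _ = n := by simp
    _ = √n ^ n := by simp

theorem one_le_abs_det_of_sign_entries {ι : Type*} [Fintype ι] [DecidableEq ι] (M : Matrix ι ι ℝ)
    (hM : ∀ i j, M i j = 1 ∨ M i j = -1) (hdet : M.det ≠ 0) : 1 ≤ |M.det| := by
  have hint : ∀ i j, ∃ z : ℤ, (z : ℝ) = M i j := fun i j => by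
    rcases hM i j with h | h
    · exact ⟨1, by simp [h]⟩
    · exact ⟨-1, by simp [h]⟩
  choose N hN using hint
  have hMN : M.det = ((Matrix.of N).det : ℤ) := by
    rw [Int.cast_det]
    congr 1
    ext i j
    exact (hN i j).symm
  rw [hMN] at hdet ⊢
  exact_mod_cast Int.one_le_abs (by exact_mod_cast hdet)

theorem exists_submatrix_det_ne_zero {K m ι : Type*} [Field K] [Finite m] [Fintype ι]
    [DecidableEq ι] (M : Matrix m ι K) (hM : LinearIndependent K M.col) :
    ∃ f : ι → m, (M.submatrix f id).det ≠ 0 := by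
  have hrank : Module.finrank K (Submodule.span K (Set.range M.row)) = Fintype.card ι := by
    rw [← M.rank_eq_finrank_span_row, M.rank_eq_finrank_span_cols, finrank_span_eq_card hM]
  obtain ⟨g, hg, -, hli⟩ := Submodule.exists_fun_fin_finrank_span_eq K (Set.range M.row)
  choose f hf using hg
  let e : ι ≃ Fin (Module.finrank K (Submodule.span K (Set.range M.row))) :=
    Fintype.equivFinOfCardEq hrank.symm
  refine ⟨f ∘ e, ?_⟩
  rw [← isUnit_iff_ne_zero, ← Matrix.isUnit_iff_isUnit_det,
    ← Matrix.linearIndependent_rows_iff_isUnit]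
  have hrow : (M.submatrix (f ∘ e) id).row = g ∘ e := funext fun i => hf (e i)
  rw [hrow]
  exact hli.comp e e.injective

/-- A solution of a full-column-rank linear system with sign coefficients and a right-hand side
bounded by one is bounded, by Cramer's rule and Hadamard's inequality. -/
theorem abs_le_sqrt_card_pow_of_mulVec {m ι : Type*} [Finite m] [Fintype ι]
    (M : Matrix m ι ℝ) (hM : ∀ i j, M i j = 1 ∨ M i j = -1) (hli : LinearIndependent ℝ M.col)
    (x : ι → ℝ) (hx : ∀ i, |(M *ᵥ x) i| ≤ 1) (a : ι) :
    |x a| ≤ √(Fintype.card ι) ^ Fintype.card ι := by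
  classical
  obtain ⟨f, hf⟩ := exists_submatrix_det_ne_zero M hli
  set N := M.submatrix f id with hN
  have hcramer : N.det * x a = (N.updateCol a (N *ᵥ x)).det := by
    rw [← Matrix.cramer_apply, Matrix.cramer_eq_adjugate_mulVec, Matrix.mulVec_mulVec,
      Matrix.adjugate_mul, Matrix.smul_mulVec, Matrix.one_mulVec, Pi.smul_apply, smul_eq_mul]
  have hone : 1 ≤ |N.det| := one_le_abs_det_of_sign_entries N (fun i j => hM _ _) hf
  calc |x a| ≤ |N.det| * |x a| := le_mul_of_one_le_left (abs_nonneg _) hone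
    _ = |(N.updateCol a (N *ᵥ x)).det| := by rw [← abs_mul, hcramer]
    _ ≤ _ := by
      refine abs_det_le_sqrt_card_pow _ fun i j => ?_
      rw [Matrix.updateCol_apply]
      split_ifs
      · exact hx (f i)
      · rcases hM (f i) j with h | h <;> simp [hN, h]

/-- The sign vectors `p a` with weights `w a` reproduce the off-diagonal entries of `A`. -/
def IsPulseRepr {κ V : Type*} [Fintype κ] (p : κ → V → ℝ) (w : κ → ℝ) (A : Matrix V V ℝ) : Prop :=
  (∀ a i, p a i = 1 ∨ p a i = -1) ∧ ∀ i j, i ≠ j → ∑ a, w a * (p a i * p a j) = A i j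

/-- Every graph on `m + 1` vertices is a sum of `m` stars, each of which needs four pulses, one
of them shared by all the stars. -/
theorem exists_isPulseRepr (m : ℕ) (A : Matrix (Fin (m + 1)) (Fin (m + 1)) ℝ) (hA : A.IsSymm)
    (h01 : ∀ i j, A i j = 0 ∨ A i j = 1) :
    ∃ (p : Option (Fin m × Fin 3) → Fin (m + 1) → ℝ) (w : Option (Fin m × Fin 3) → ℝ),
      IsPulseRepr p w A := by
  classical
  let s : Fin m → Fin (m + 1) → ℝ := fun c j => if j < c.succ ∧ A c.succ j = 1 then 1 else -1
  let p : Option (Fin m × Fin 3) → Fin (m + 1) → ℝ := fun a j => a.elim 1 fun q =>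
    (![if j = q.1.succ then -1 else 1, if j = q.1.succ then 1 else s q.1 j,
      if j = q.1.succ then -1 else s q.1 j] : Fin 3 → ℝ) q.2
  let w : Option (Fin m × Fin 3) → ℝ := fun a => a.elim (m / 4) fun q =>
    (![-1 / 4, 1 / 4, -1 / 4] : Fin 3 → ℝ) q.2
  have hs : ∀ c j, s c j = 1 ∨ s c j = -1 := fun c j => by
    simp only [s]; split_ifs <;> simp
  refine ⟨p, w, ?_, ?_⟩
  · rintro (_ | ⟨c, t⟩) j
    · simp [p]
    · fin_cases t <;> simp only [p, Option.elim] <;> by_cases h : j = c.succ <;> simp [h, hs]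
  · have key : ∀ i j, i < j → ∑ a, w a * (p a i * p a j) = A i j := by
      intro i j hij
      have hterm : ∀ c : Fin m,
          ∑ t, w (some (c, t)) * (p (some (c, t)) i * p (some (c, t)) j) =
            (if j = c.succ then A i j else 0) - 1 / 4 := by
        intro c
        simp only [w, p, Option.elim, Fin.sum_univ_three, Matrix.cons_val]
        by_cases hj : j = c.succ
        · have hi : i ≠ c.succ := hj ▸ hij.ne
          have hsym : A c.succ i = A i c.succ := hA.apply _ _
          have hlt : i < c.succ := hj ▸ hij
          simp only [s, hi, hj, hlt, hsym, if_true, if_false, true_and]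
          rcases h01 i c.succ with h | h <;> norm_num [h]
        · by_cases hi : i = c.succ
          · have hlt : ¬ j < c.succ := hi ▸ hij.not_gt
            simp [s, hi, hj, hlt]
          · simp only [hi, hj, if_false]
            ring
      obtain ⟨d, rfl⟩ := Fin.exists_succ_eq.mpr (Fin.ne_zero_of_lt hij)
      rw [Fintype.sum_option, Fintype.sum_prod_type]
      simp only [hterm]
      simp [w, p]
      ring
    intro i j hij
    rcases lt_or_gt_of_ne hij with h | h
    · exact key i j h
    · rw [← hA.apply, ← key j i h]
      simp only [mul_comm (p _ i)]

/-- The pulses of a representation with the fewest nonzero weights are linearly independent. -/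
theorem linearIndependent_of_isPulseRepr_minimal {ι V : Type*} [Fintype ι] {A : Matrix V V ℝ}
    {p : ι → V → ℝ} {w : ι → ℝ} (h : IsPulseRepr p w A)
    (hmin : ∀ w' : ι → ℝ, IsPulseRepr p w' A → ∀ a, w' a ≠ 0) :
    LinearIndependent ℝ
      (Matrix.of fun (q : {q : V × V // q.1 ≠ q.2}) (a : ι) => p a q.1.1 * p a q.1.2).col := by
  by_contra hli
  obtain ⟨g, hg, b, hb⟩ := Fintype.not_linearIndependent_iff.mp hli
  refine hmin (fun a => w a - w b / g b * g a) ⟨h.1, fun i j hij => ?_⟩ b (by field_simp; simp)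
  have h0 : ∑ a, g a * (p a i * p a j) = 0 := by
    simpa using congrFun hg ⟨(i, j), hij⟩
  simp only [sub_mul, Finset.sum_sub_distrib, mul_assoc, ← Finset.mul_sum]
  rw [h0, h.2 i j hij]
  simp

theorem hadamard_Jmat_eq_iff {n k : ℕ} {A : Matrix (Fin n) (Fin n) ℝ} (hA : ∀ i, A i i = 0)
    (P : Matrix (Fin k) (Fin n) ℝ) (w : Fin k → ℝ) :
    (Pᵀ * Matrix.diagonal w * P).hadamard (Jmat n) = A ↔
      ∀ i j, i ≠ j → ∑ a, w a * (P a i * P a j) = A i j := by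
  have hentry : ∀ i j, (Pᵀ * Matrix.diagonal w * P) i j = ∑ a, w a * (P a i * P a j) := by
    intro i j
    rw [Matrix.mul_apply]
    refine Finset.sum_congr rfl fun a _ => ?_
    rw [Matrix.mul_diagonal, Matrix.transpose_apply]
    ring
  rw [← Matrix.ext_iff]
  refine forall₂_congr fun i j => ?_
  rw [Matrix.hadamard_apply, hentry, Jmat]
  by_cases h : i = j
  · subst h
    simp [hA]
  · simp [h]

theorem stmt_14 (n k : ℕ) (hn : 1 ≤ n)
    (A : Matrix (Fin n) (Fin n) ℝ) (hAs : A.IsSymm) (hAd : ∀ i, A i i = 0)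
    (h01 : ∀ i j : Fin n, A i j = 0 ∨ A i j = 1)
    (P : Matrix (Fin k) (Fin n) ℝ) (hP : ∀ a i, P a i = 1 ∨ P a i = -1)
    (W : Matrix (Fin k) (Fin k) ℝ) (hWd : W.IsDiag)
    (hEq : (Pᵀ * W * P).hadamard (Jmat n) = A)
    (r : ℕ) (hr : r = (Finset.univ.filter fun a : Fin k => W a a ≠ 0).card)
    (hr1 : 1 < r)
    (hopt : ∀ k' : ℕ, 1 ≤ k' → ∀ P' : Matrix (Fin k') (Fin n) ℝ,
      (∀ a i, P' a i = 1 ∨ P' a i = -1) → ∀ W' : Matrix (Fin k') (Fin k') ℝ,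
      W'.IsDiag → (P'ᵀ * W' * P').hadamard (Jmat n) = A →
      r ≤ (Finset.univ.filter fun a : Fin k' => W' a a ≠ 0).card) :
    ∀ a : Fin k, |W a a| ≤ (3 * (n : ℝ) - 2) ^ ((3 * (n : ℝ) - 1) / 2) := by
  obtain ⟨m, rfl⟩ : ∃ m, n = m + 1 := ⟨n - 1, by omega⟩
  have hmin : ∀ {κ : Type} [Fintype κ] [Nonempty κ] (p : κ → Fin (m + 1) → ℝ) (w : κ → ℝ),
      IsPulseRepr p w A → r ≤ (Finset.univ.filter fun a => w a ≠ 0).card := by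
    intro κ _ _ p w h
    let e : Fin (Fintype.card κ) ≃ κ := (Fintype.equivFin κ).symm
    refine (hopt _ Fintype.card_pos (Matrix.of (p ∘ e)) (fun a i => h.1 (e a) i)
      (Matrix.diagonal (w ∘ e)) (Matrix.isDiag_diagonal _) ?_).trans_eq ?_
    · rw [hadamard_Jmat_eq_iff hAd]
      intro i j hij
      rw [← h.2 i j hij]
      exact e.sum_comp fun a => w a * (p a i * p a j)
    · refine Finset.card_equiv e fun a => ?_
      simp
  obtain ⟨w, rfl⟩ : ∃ w, W = Matrix.diagonal w := ⟨_, hWd.diagonal_diag.symm⟩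
  rw [hadamard_Jmat_eq_iff hAd] at hEq
  simp only [Matrix.diagonal_apply_eq] at hr ⊢
  have hrle : r ≤ 3 * m + 1 := by
    obtain ⟨p, w', h⟩ := exists_isPulseRepr m A hAs h01
    refine (hmin p w' h).trans ((Finset.card_le_univ _).trans_eq ?_)
    simp [mul_comm]
  let ι := {a : Fin k // w a ≠ 0}
  have hcard : Fintype.card ι = r := by rw [hr, Fintype.card_subtype]
  have : Nonempty ι := Fintype.card_pos_iff.mp (by omega)
  have hrepr : IsPulseRepr (fun a : ι => P a) (fun a : ι => w a) A := by
    refine ⟨fun a i => hP a i, fun i j hij => ?_⟩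
    rw [← hEq i j hij,
      ← Finset.sum_filter_of_ne (p := fun a => w a ≠ 0) fun a _ h => left_ne_zero_of_mul h]
    exact (Finset.sum_subtype (Finset.univ.filter fun a => w a ≠ 0)
      (fun _ => Finset.mem_filter_univ _) fun a => w a * (P a i * P a j)).symm
  have hli := linearIndependent_of_isPulseRepr_minimal hrepr fun w' h' a => by
    have hfull : Finset.univ.filter (fun a => w' a ≠ 0) = Finset.univ :=
      Finset.eq_univ_of_card _ (le_antisymm (Finset.card_le_univ _) (hcard ▸ hmin _ w' h'))
    exact (Finset.mem_filter_univ a).mp (hfull ▸ Finset.mem_univ a)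
  have hbound : ∀ a : ι, |w a| ≤ √r ^ r := fun a => by
    rw [← hcard]
    refine abs_le_sqrt_card_pow_of_mulVec _ (fun q b => ?_) hli (fun a : ι => w a)
      (fun q => ?_) a
    · rcases hP b q.1.1 with h₁ | h₁ <;> rcases hP b q.1.2 with h₂ | h₂ <;> simp [h₁, h₂]
    · have hq : (Matrix.of (fun (q : {q : Fin (m + 1) × Fin (m + 1) // q.1 ≠ q.2}) (a : ι) =>
          P a q.1.1 * P a q.1.2) *ᵥ fun a : ι => w a) q = A q.1.1 q.1.2 := by
        rw [← hrepr.2 _ _ q.2]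
        simp only [Matrix.mulVec, dotProduct, Matrix.of_apply, mul_comm (w _)]
      rw [hq]
      rcases h01 q.1.1 q.1.2 with h | h <;> simp [h]
  have hbase : (3 * ((m + 1 : ℕ) : ℝ) - 2) = 3 * m + 1 := by push_cast; ring
  have hbase1 : (1 : ℝ) ≤ 3 * m + 1 := by linarith [(Nat.cast_nonneg m : (0 : ℝ) ≤ m)]
  have hrle' : (r : ℝ) ≤ 3 * m + 1 := by exact_mod_cast hrle
  intro a
  rw [hbase]
  by_cases ha : w a = 0
  · rw [ha, abs_zero]
    positivity
  calc |w a| ≤ √r ^ r := hbound ⟨a, ha⟩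
    _ = (r : ℝ) ^ ((r : ℝ) / 2) := by
      rw [Real.sqrt_eq_rpow, ← Real.rpow_natCast, ← Real.rpow_mul (Nat.cast_nonneg r)]
      ring_nf
    _ ≤ (3 * m + 1 : ℝ) ^ ((r : ℝ) / 2) := by gcongr
    _ ≤ _ := by
      refine Real.rpow_le_rpow_of_exponent_le hbase1 ?_
      push_cast
      linarith
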